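/- arXiv:2601.02142 — 2 statements merged into one kernel-verified Lean document; each statement's English description precedes it below -/
import Mathlib

section
/- Let 0 < α < 1 and λ > 0. Then for every ξ ∈ ℝ, ∫_0^∞ s^{α−1} E_{α,α}(−λ s^α) e^{−iξs} ds = 1 / ((iξ)^α + λ), where (iξ)^α = |ξ|^α e^{iαπ·sgn(ξ)/2} is the principal branch. In particular, the Fourier transform of the causal Green kernel g(s) = s^{α−1}E_{α,α}(−λ s^α)·Θ(s) (Θ the Heaviside function) is the spectral symbol ((iξ)^α + λ)^{-1}. -/
open MeasureTheory Set Filter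

noncomputable section

/-- The two-parameter Mittag-Leffler function (real argument). -/
def mlE (α β x : ℝ) : ℝ := ∑' k : ℕ, x ^ k / Real.Gamma (α * k + β)

/-- The Riemann-Liouville kernel of order `a`. -/
def rlKernel (a s : ℝ) : ℝ := s ^ (a - 1) / Real.Gamma a

/-- The causal Green kernel of fractional relaxation. -/
def mlKernel (α lam s : ℝ) : ℝ := s ^ (α - 1) * mlE α α (-(lam * s ^ α))

lemma rlKernel_pos {a s : ℝ} (ha : 0 < a) (hs : 0 < s) : 0 < rlKernel a s :=
  div_pos (Real.rpow_pos_of_pos hs _) (Real.Gamma_pos_of_pos ha)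

lemma rlKernel_nonneg {a s : ℝ} (ha : 0 < a) (hs : 0 ≤ s) : 0 ≤ rlKernel a s :=
  div_nonneg (Real.rpow_nonneg hs _) (Real.Gamma_pos_of_pos ha).le

lemma exp_mul_rpow_le_Gamma {M y : ℝ} (hM : 0 < M) (hy : 1 ≤ y) :
    Real.exp (-(2 * M)) * M ^ y ≤ Real.Gamma y := by
  have hy0 : 0 < y := by linarith
  have key := Real.integral_rpow_mul_exp_neg_mul_Ioi hy0 hM
  have hΓ := Real.Gamma_pos_of_pos hy0
  have hint : IntegrableOn (fun x ↦ x ^ (y - 1) * Real.exp (-(M * x))) (Ioi 0) :=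
    .of_integral_ne_zero (by rw [key]; positivity)
  have h1 : ∫ x in Ioc (1 : ℝ) 2, x ^ (y - 1) * Real.exp (-(M * x)) ≤
      (1 / M) ^ y * Real.Gamma y := by
    rw [← key]
    apply setIntegral_mono_set hint
    · filter_upwards [ae_restrict_mem measurableSet_Ioi] with x (hx : 0 < x)
      simp only [Pi.zero_apply]
      positivity
    · have hsub : Ioc (1 : ℝ) 2 ⊆ Ioi 0 := fun x hx => lt_trans one_pos hx.1
      exact hsub.eventuallyLE
  have h2 : Real.exp (-(2 * M)) ≤ ∫ x in Ioc (1 : ℝ) 2, x ^ (y - 1) * Real.exp (-(M * x)) := by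
    have : ∫ _x in Ioc (1 : ℝ) 2, Real.exp (-(2 * M)) = Real.exp (-(2 * M)) := by
      simp
      norm_num
    rw [← this]
    apply setIntegral_mono_on
    · simp
    · exact hint.mono_set (fun x hx => lt_trans one_pos hx.1 : Ioc (1 : ℝ) 2 ⊆ Ioi 0)
    · exact measurableSet_Ioc
    · intro x hx
      have a1 : 1 ≤ x ^ (y - 1) := Real.one_le_rpow hx.1.le (by linarith)
      have a2 : Real.exp (-(2 * M)) ≤ Real.exp (-(M * x)) := by
        apply Real.exp_le_exp.2
        nlinarith [hx.2]
      nlinarith [Real.exp_pos (-(2 * M))]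
  have h3 := h2.trans h1
  rw [one_div, Real.inv_rpow hM.le] at h3
  have hMy : 0 < M ^ y := Real.rpow_pos_of_pos hM y
  calc Real.exp (-(2 * M)) * M ^ y ≤ ((M ^ y)⁻¹ * Real.Gamma y) * M ^ y := by gcongr
    _ = Real.Gamma y := by field_simp

lemma summable_pow_div_Gamma {α : ℝ} (hα : 0 < α) {R : ℝ} (hR : 0 ≤ R) :
    Summable fun k : ℕ => R ^ k / Real.Gamma (α * k + α) := by
  obtain ⟨M, hM0, hM⟩ : ∃ M : ℝ, 0 < M ∧ M ^ α = 2 * (R + 1) := by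
    refine ⟨(2 * (R + 1)) ^ α⁻¹, by positivity, ?_⟩
    rw [← Real.rpow_mul (by positivity), inv_mul_cancel₀ hα.ne', Real.rpow_one]
  have hg : Summable fun k : ℕ => (Real.exp (2 * M) * (M ^ α)⁻¹) * (1 / 2 : ℝ) ^ k :=
    (summable_geometric_of_lt_one (by norm_num) (by norm_num)).mul_left _
  refine hg.of_norm_bounded_eventually_nat ?_
  filter_upwards [eventually_ge_atTop ⌈α⁻¹⌉₊] with k hk
  have hk1 : 1 ≤ α * k + α := by
    have : α⁻¹ ≤ k := (Nat.le_ceil _).trans (by exact_mod_cast hk)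
    have h2 : α * α⁻¹ ≤ α * k := by gcongr
    rw [mul_inv_cancel₀ hα.ne'] at h2
    linarith
  have hΓ := exp_mul_rpow_le_Gamma hM0 hk1
  have hΓ0 : 0 < Real.Gamma (α * k + α) := Real.Gamma_pos_of_pos (by linarith)
  rw [Real.rpow_add hM0, Real.rpow_mul hM0.le, Real.rpow_natCast, hM, Real.exp_neg] at hΓ
  rw [Real.norm_of_nonneg (by positivity), hM, div_le_iff₀ hΓ0]
  have hp : R ^ k ≤ (R + 1) ^ k := pow_le_pow_left₀ hR (by linarith) k
  calc R ^ k ≤ (R + 1) ^ k := hp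
    _ = Real.exp (2 * M) * (2 * (R + 1))⁻¹ * (1 / 2) ^ k *
        ((Real.exp (2 * M))⁻¹ * ((2 * (R + 1)) ^ k * (2 * (R + 1)))) := by
        rw [mul_pow, one_div, inv_pow]
        field_simp
    _ ≤ _ := by gcongr

lemma continuous_mlE {α : ℝ} (hα : 0 < α) : Continuous (mlE α α) := by
  rw [continuous_iff_continuousAt]
  intro x
  have hx : Icc (-(|x| + 1)) (|x| + 1) ∈ nhds x :=
    Icc_mem_nhds (by linarith [neg_abs_le x]) (by linarith [le_abs_self x])
  refine ContinuousOn.continuousAt ?_ hx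
  refine continuousOn_tsum (fun k => by fun_prop)
    (summable_pow_div_Gamma hα (R := |x| + 1) (by positivity)) ?_
  intro k y hy
  have hΓ : 0 < Real.Gamma (α * k + α) := Real.Gamma_pos_of_pos (by positivity)
  rw [norm_div, norm_pow, Real.norm_eq_abs, Real.norm_of_nonneg hΓ.le]
  gcongr
  exact abs_le.2 hy

lemma summable_mul_rlKernel {α : ℝ} (hα : 0 < α) {R t : ℝ} (hR : 0 ≤ R) (ht : 0 < t) :
    Summable fun n : ℕ => R ^ n * rlKernel (α * n + α) t := by
  have h := (summable_pow_div_Gamma hα (R := R * t ^ α) (by positivity)).mul_left (t ^ (α - 1))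
  refine h.congr fun n => ?_
  rw [rlKernel, add_sub_assoc, Real.rpow_add ht, Real.rpow_mul ht.le, Real.rpow_natCast]
  ring

lemma mlKernel_eq_tsum {α lam s : ℝ} (hs : 0 < s) :
    mlKernel α lam s = ∑' n : ℕ, (-lam) ^ n * rlKernel (α * n + α) s := by
  rw [mlKernel, mlE, ← tsum_mul_left]
  congr 1 with n
  rw [rlKernel, add_sub_assoc, Real.rpow_add hs, Real.rpow_mul hs.le, Real.rpow_natCast,
    ← neg_mul, mul_pow]
  ring

lemma integral_rlKernel_mul_rlKernel {a b t : ℝ} (ha : 0 < a) (hb : 0 < b) (ht : 0 < t) :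
    ∫ s in (0 : ℝ)..t, rlKernel b (t - s) * rlKernel a s = rlKernel (a + b) t := by
  have hG := Real.Gamma_pos_of_pos ha
  have hG' := Real.Gamma_pos_of_pos hb
  have hG2 := Real.Gamma_pos_of_pos (add_pos ha hb)
  have h := Complex.betaIntegral_scaled (a : ℂ) (b : ℂ) ht
  rw [Complex.betaIntegral_eq_Gamma_mul_div _ _ (by simpa) (by simpa)] at h
  have h2 : ∫ s in (0 : ℝ)..t, s ^ (a - 1) * (t - s) ^ (b - 1) =
      t ^ (a + b - 1) * (Real.Gamma a * Real.Gamma b / Real.Gamma (a + b)) := by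
    rw [← Complex.ofReal_inj, ← intervalIntegral.integral_ofReal]
    push_cast
    rw [Complex.ofReal_cpow ht.le, ← Complex.Gamma_ofReal, ← Complex.Gamma_ofReal,
      ← Complex.Gamma_ofReal]
    push_cast
    rw [← h]
    refine intervalIntegral.integral_congr fun s hs => ?_
    rw [uIcc_of_le ht.le] at hs
    rw [Complex.ofReal_cpow hs.1, Complex.ofReal_cpow (sub_nonneg.2 hs.2)]
    push_cast
    rfl
  have h3 : (fun s => rlKernel b (t - s) * rlKernel a s) = fun s =>
      (Real.Gamma a * Real.Gamma b)⁻¹ * (s ^ (a - 1) * (t - s) ^ (b - 1)) := by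
    ext s
    rw [rlKernel, rlKernel]
    field_simp
  rw [h3, intervalIntegral.integral_const_mul, h2, rlKernel]
  field_simp

lemma intervalIntegrable_rlKernel_mul_rlKernel {a b t : ℝ} (ha : 0 < a) (hb : 0 < b)
    (ht : 0 < t) :
    IntervalIntegrable (fun s => rlKernel b (t - s) * rlKernel a s) volume 0 t := by
  rw [intervalIntegrable_iff_integrableOn_Ioc_of_le ht.le]
  refine .of_integral_ne_zero ?_
  rw [← intervalIntegral.integral_of_le ht.le, integral_rlKernel_mul_rlKernel ha hb ht]
  exact (rlKernel_pos (add_pos ha hb) ht).ne'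

lemma continuous_mlE_comp {α : ℝ} (hα : 0 < α) (lam : ℝ) :
    Continuous fun s : ℝ => mlE α α (-(lam * s ^ α)) :=
  (continuous_mlE hα).comp
    ((continuous_const.mul (continuous_id.rpow_const fun _ => Or.inr hα.le)).neg)

lemma intervalIntegrable_mlKernel {α : ℝ} (hα : 0 < α) (lam t : ℝ) :
    IntervalIntegrable (mlKernel α lam) volume 0 t :=
  (intervalIntegral.intervalIntegrable_rpow' (by linarith)).mul_continuousOn
    (continuous_mlE_comp hα lam).continuousOn

lemma intervalIntegrable_rlKernel_mul_mlKernel {α : ℝ} (hα : 0 < α) (lam : ℝ) {t : ℝ}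
    (ht : 0 < t) :
    IntervalIntegrable (fun s => rlKernel α (t - s) * mlKernel α lam s) volume 0 t := by
  have hΓ := Real.Gamma_pos_of_pos hα
  refine ((intervalIntegrable_rlKernel_mul_rlKernel hα hα ht).mul_continuousOn
    (g := fun s => Real.Gamma α * mlE α α (-(lam * s ^ α)))
    (continuous_const.mul (continuous_mlE_comp hα lam)).continuousOn).congr ?_
  intro s _
  simp only [rlKernel, mlKernel]
  field_simp

/-- The Volterra resolvent equation satisfied by the Green kernel. -/
lemma mlKernel_volterra {α lam t : ℝ} (hα : 0 < α) (hlam : 0 < lam) (ht : 0 < t) :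
    mlKernel α lam t = rlKernel α t -
      lam * ∫ s in (0 : ℝ)..t, rlKernel α (t - s) * mlKernel α lam s := by
  have ha (n : ℕ) : 0 < α * n + α := by positivity
  set F : ℕ → ℝ → ℝ := fun n s => rlKernel α (t - s) * ((-lam) ^ n * rlKernel (α * n + α) s)
  have hF (n : ℕ) : F n = fun s => (-lam) ^ n * (rlKernel α (t - s) * rlKernel (α * n + α) s) := by
    ext s; simp only [F]; ring
  have hshift (n : ℕ) : α * n + α + α = α * (n + 1 : ℕ) + α := by push_cast; ring
  have hFint (n : ℕ) : Integrable (F n) (volume.restrict (Ioc 0 t)) := by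
    rw [hF]
    exact (((intervalIntegrable_iff_integrableOn_Ioc_of_le ht.le).1
      (intervalIntegrable_rlKernel_mul_rlKernel (ha n) hα ht))).const_mul _
  have hFval (n : ℕ) : ∫ s in Ioc 0 t, F n s = (-lam) ^ n * rlKernel (α * (n + 1 : ℕ) + α) t := by
    rw [hF, integral_const_mul, ← intervalIntegral.integral_of_le ht.le,
      integral_rlKernel_mul_rlKernel (ha n) hα ht, hshift]
  have hFnorm (n : ℕ) : ∫ s in Ioc 0 t, ‖F n s‖ =
      lam ^ n * rlKernel (α * (n + 1 : ℕ) + α) t := by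
    rw [← hshift, ← integral_rlKernel_mul_rlKernel (ha n) hα ht,
      intervalIntegral.integral_of_le ht.le, ← integral_const_mul]
    refine setIntegral_congr_fun measurableSet_Ioc fun s hs => ?_
    simp only [hF]
    rw [norm_mul, norm_pow, norm_neg, Real.norm_of_nonneg hlam.le, Real.norm_of_nonneg
      (mul_nonneg (rlKernel_nonneg hα (sub_nonneg.2 hs.2)) (rlKernel_nonneg (ha n) hs.1.le))]
  have hsum := summable_mul_rlKernel hα hlam.le ht
  have hsumF : Summable fun n => ∫ s in Ioc 0 t, ‖F n s‖ := by
    simp_rw [hFnorm]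
    refine (((summable_nat_add_iff 1).2 hsum).mul_left lam⁻¹).congr fun n => ?_
    rw [pow_succ]
    field_simp
  have key := (hasSum_integral_of_summable_integral_norm hFint hsumF).tsum_eq
  have hrhs : ∫ s in Ioc 0 t, ∑' n, F n s =
      ∫ s in (0 : ℝ)..t, rlKernel α (t - s) * mlKernel α lam s := by
    rw [intervalIntegral.integral_of_le ht.le]
    refine setIntegral_congr_fun measurableSet_Ioc fun s hs => ?_
    simp only [F]
    rw [tsum_mul_left, mlKernel_eq_tsum hs.1]
  rw [← hrhs, ← key, mlKernel_eq_tsum ht]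
  have hsum' : Summable fun n : ℕ => (-lam) ^ n * rlKernel (α * n + α) t := by
    refine Summable.of_norm (hsum.congr fun n => ?_)
    rw [norm_mul, norm_pow, norm_neg, Real.norm_of_nonneg hlam.le,
      Real.norm_of_nonneg (rlKernel_pos (ha n) ht).le]
  rw [hsum'.tsum_eq_zero_add, ← tsum_mul_left]
  simp_rw [hFval]
  simp only [pow_zero, Nat.cast_zero, mul_zero, zero_add, one_mul, sub_eq_add_neg]
  rw [← tsum_neg]
  congr 2 with n
  rw [pow_succ]
  ring

lemma integrableOn_rpow_mul_exp_neg_mul {a r : ℝ} (ha : 0 < a) (hr : 0 < r) :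
    IntegrableOn (fun x : ℝ ↦ x ^ (a - 1) * Real.exp (-(r * x))) (Ioi 0) := by
  refine .of_integral_ne_zero ?_
  rw [Real.integral_rpow_mul_exp_neg_mul_Ioi ha hr]
  have := Real.Gamma_pos_of_pos ha
  positivity

/-- The Laplace transform of a power, at a complex argument in the right half-plane. -/
lemma integral_rpow_mul_cexp_neg_mul_Ioi {a : ℝ} (ha : 0 < a) {p : ℂ} (hp : 0 < p.re) :
    ∫ s in Ioi (0 : ℝ), ((s ^ (a - 1) : ℝ) : ℂ) * Complex.exp (-(p * s)) =
      (p ^ (a : ℂ))⁻¹ * Real.Gamma a := by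
  set μ : Measure ℝ :=
    (volume.restrict (Ioi (0 : ℝ))).withDensity (fun s => ENNReal.ofReal (s ^ (a - 1))) with hμ
  have hmeas : Measurable fun s : ℝ => ENNReal.ofReal (s ^ (a - 1)) := by fun_prop
  have hfin : ∀ᵐ s ∂(volume.restrict (Ioi (0 : ℝ))), ENNReal.ofReal (s ^ (a - 1)) < ⊤ :=
    Eventually.of_forall fun s => ENNReal.ofReal_lt_top
  have hμint (z : ℂ) : ProbabilityTheory.complexMGF (fun s => -s) μ z =
      ∫ s in Ioi (0 : ℝ), ((s ^ (a - 1) : ℝ) : ℂ) * Complex.exp (-(z * s)) := by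
    rw [ProbabilityTheory.complexMGF, hμ, integral_withDensity_eq_integral_toReal_smul hmeas hfin]
    refine setIntegral_congr_fun measurableSet_Ioi fun s hs => ?_
    rw [ENNReal.toReal_ofReal (Real.rpow_nonneg (le_of_lt hs) _), Complex.real_smul]
    push_cast
    rw [mul_neg]
  have hexp : Ioi (0 : ℝ) ⊆ ProbabilityTheory.integrableExpSet (fun s => -s) μ := by
    intro r hr
    rw [ProbabilityTheory.integrableExpSet, mem_ofPred_eq, hμ,
      integrable_withDensity_iff_integrable_smul' hmeas hfin]
    refine (integrableOn_rpow_mul_exp_neg_mul ha hr).congr_fun (fun s hs => ?_) measurableSet_Ioi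
    simp only
    rw [ENNReal.toReal_ofReal (Real.rpow_nonneg (le_of_lt hs) _), smul_eq_mul, mul_neg]
  have hconv : Convex ℝ {z : ℂ | 0 < z.re} := convex_halfSpace_re_gt 0
  have hopen : IsOpen {z : ℂ | 0 < z.re} := isOpen_lt continuous_const Complex.continuous_re
  have hL : AnalyticOnNhd ℂ (ProbabilityTheory.complexMGF (fun s => -s) μ) {z : ℂ | 0 < z.re} :=
    ProbabilityTheory.analyticOnNhd_complexMGF.mono fun z hz =>
      interior_mono hexp (by rwa [isOpen_Ioi.interior_eq])
  have hR : AnalyticOnNhd ℂ (fun z : ℂ => (z ^ (a : ℂ))⁻¹ * (Real.Gamma a : ℂ))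
      {z : ℂ | 0 < z.re} := by
    refine DifferentiableOn.analyticOnNhd (fun z hz => ?_) hopen
    have hz0 : z ≠ 0 := by
      rintro rfl
      simp at hz
    have hd : DifferentiableAt ℂ (fun z : ℂ => z ^ (a : ℂ)) z :=
      differentiableAt_id.cpow_const (Or.inl hz)
    exact ((hd.inv (by simp [Complex.cpow_eq_zero_iff, hz0])).mul_const _).differentiableWithinAt
  have htend : Tendsto (fun x : ℝ => (x : ℂ)) (nhdsWithin 1 (Ioi 1)) (nhdsWithin 1 {1}ᶜ) := by
    refine tendsto_nhdsWithin_iff.2 ⟨?_, ?_⟩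
    · have := (Complex.continuous_ofReal.tendsto 1)
      rw [Complex.ofReal_one] at this
      exact this.mono_left nhdsWithin_le_nhds
    · filter_upwards [self_mem_nhdsWithin] with x (hx : 1 < x)
      simpa using hx.ne'
  have hfreq : ∃ᶠ z in nhdsWithin (1 : ℂ) {1}ᶜ, ProbabilityTheory.complexMGF (fun s => -s) μ z =
      (z ^ (a : ℂ))⁻¹ * (Real.Gamma a : ℂ) := by
    refine htend.frequently (Eventually.frequently ?_)
    filter_upwards [self_mem_nhdsWithin] with x (hx : 1 < x)
    have hx0 : 0 < x := by linarith
    have h := Real.integral_rpow_mul_exp_neg_mul_Ioi ha hx0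
    rw [hμint, ← Complex.ofReal_cpow hx0.le, ← Complex.ofReal_inv, ← Complex.ofReal_mul,
      ← Real.inv_rpow hx0.le, ← one_div, ← h, ← integral_complex_ofReal]
    push_cast
    rfl
  rw [← hμint]
  exact hL.eqOn_of_preconnected_of_frequently_eq hR hconv.isPreconnected
    (by simp : (1 : ℂ) ∈ {z : ℂ | 0 < z.re}) hfreq hp

lemma rlKernel_mul_rlKernel_le {α s t T : ℝ} (hα : 0 < α) (hα1 : α < 1) (hs : 0 < s)
    (hst : s < t) (htT : t < T) :
    rlKernel α (T - s) * rlKernel α t ≤ rlKernel α (t - s) * rlKernel α T := by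
  have hΓ := Real.Gamma_pos_of_pos hα
  have h : ((T - s) * t) ^ (α - 1) ≤ ((t - s) * T) ^ (α - 1) := by
    refine Real.rpow_le_rpow_of_nonpos (mul_pos (by linarith) (by linarith)) ?_ (by linarith)
    nlinarith
  rw [Real.mul_rpow (by linarith) (by linarith), Real.mul_rpow (by linarith) (by linarith)] at h
  simp only [rlKernel]
  rw [div_mul_div_comm, div_mul_div_comm]
  gcongr

lemma rlKernel_anti {α s t : ℝ} (hα : 0 < α) (hα1 : α < 1) (hs : 0 < s) (hst : s ≤ t) :
    rlKernel α t ≤ rlKernel α s :=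
  div_le_div_of_nonneg_right (Real.rpow_le_rpow_of_nonpos hs hst (by linarith))
    (Real.Gamma_pos_of_pos hα).le

lemma integral_rlKernel_sub {α t T : ℝ} (hα : 0 < α) :
    ∫ s in t..T, rlKernel α (T - s) = (T - t) ^ α / (α * Real.Gamma α) := by
  rw [intervalIntegral.integral_comp_sub_left (fun s => rlKernel α s) T]
  simp only [rlKernel, sub_self]
  rw [intervalIntegral.integral_div, integral_rpow (Or.inl (by linarith))]
  simp [hα.ne', div_div]

lemma mlKernel_continuousOn {α : ℝ} (hα : 0 < α) (lam : ℝ) :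
    ContinuousOn (mlKernel α lam) (Ioi 0) :=
  (continuousOn_id.rpow_const fun _ hx => Or.inl (ne_of_gt hx)).mul
    (continuous_mlE_comp hα lam).continuousOn

/-- At a local-in-the-past maximum `t` of the kernel before a nonpositive value at `T`, the
resolvent equation bounds the ratio of Riemann-Liouville kernels. -/
lemma rlKernel_le_of_mlKernel_nonpos {α lam t T : ℝ} (hα : 0 < α) (hα1 : α < 1) (hlam : 0 < lam)
    (ht : 0 < t) (htT : t < T) (hpos : ∀ s ∈ Ioo 0 T, 0 < mlKernel α lam s)
    (hT : mlKernel α lam T ≤ 0)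
    (hmax : ∀ s ∈ Icc t T, mlKernel α lam s ≤ mlKernel α lam t) :
    rlKernel α T ≤ rlKernel α t * (lam * ((T - t) ^ α / (α * Real.Gamma α))) := by
  have hT0 : 0 < T := ht.trans htT
  have hKt := rlKernel_pos hα ht
  have hKT := rlKernel_pos hα hT0
  have hgt := hpos t ⟨ht, htT⟩
  have hvT := mlKernel_volterra hα hlam hT0
  have hvt := mlKernel_volterra hα hlam ht
  have hiT := intervalIntegrable_rlKernel_mul_mlKernel hα lam hT0
  have hit := intervalIntegrable_rlKernel_mul_mlKernel hα lam ht
  have hi1 : IntervalIntegrable (fun s => rlKernel α (T - s) * mlKernel α lam s) volume 0 t :=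
    hiT.mono_set (by rw [uIcc_of_le ht.le, uIcc_of_le hT0.le]; exact Icc_subset_Icc_right htT.le)
  have hi2 : IntervalIntegrable (fun s => rlKernel α (T - s) * mlKernel α lam s) volume t T :=
    hiT.mono_set (by rw [uIcc_of_le htT.le, uIcc_of_le hT0.le]; exact Icc_subset_Icc_left ht.le)
  have hiK : IntervalIntegrable (fun s => rlKernel α (T - s)) volume t T := by
    have h0 : IntervalIntegrable (fun s => rlKernel α s) volume (T - t) (T - T) :=
      (intervalIntegral.intervalIntegrable_rpow' (by linarith)).div_const _
    simpa using h0.comp_sub_left T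
  have hfirst : (∫ s in (0 : ℝ)..t, rlKernel α (T - s) * mlKernel α lam s) * rlKernel α t ≤
      (∫ s in (0 : ℝ)..t, rlKernel α (t - s) * mlKernel α lam s) * rlKernel α T := by
    rw [← intervalIntegral.integral_mul_const, ← intervalIntegral.integral_mul_const]
    refine intervalIntegral.integral_mono_on_of_le_Ioo ht.le (hi1.mul_const _) (hit.mul_const _)
      fun s hs => ?_
    have h1 := rlKernel_mul_rlKernel_le hα hα1 hs.1 hs.2 htT
    have h2 := (hpos s ⟨hs.1, hs.2.trans htT⟩).le
    nlinarith [mul_le_mul_of_nonneg_right h1 h2]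
  have hsecond : ∫ s in t..T, rlKernel α (T - s) * mlKernel α lam s ≤
      (T - t) ^ α / (α * Real.Gamma α) * mlKernel α lam t := by
    rw [← integral_rlKernel_sub hα, ← intervalIntegral.integral_mul_const]
    refine intervalIntegral.integral_mono_on htT.le hi2 (hiK.mul_const _) fun s hs => ?_
    exact mul_le_mul_of_nonneg_left (hmax s hs) (rlKernel_nonneg hα (by linarith [hs.2]))
  rw [← intervalIntegral.integral_add_adjacent_intervals hi1 hi2] at hvT
  set A := ∫ s in (0 : ℝ)..t, rlKernel α (T - s) * mlKernel α lam s
  set B := ∫ s in t..T, rlKernel α (T - s) * mlKernel α lam s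
  set C := ∫ s in (0 : ℝ)..t, rlKernel α (t - s) * mlKernel α lam s
  set D := (T - t) ^ α / (α * Real.Gamma α)
  have h1 : rlKernel α T * rlKernel α t ≤ lam * (A + B) * rlKernel α t :=
    mul_le_mul_of_nonneg_right (by linarith) hKt.le
  have h2 : lam * (A * rlKernel α t) ≤ lam * (C * rlKernel α T) := by gcongr
  have h3 : lam * B * rlKernel α t ≤ lam * (D * mlKernel α lam t) * rlKernel α t := by gcongr
  have h4 : lam * C = rlKernel α t - mlKernel α lam t := by linarith
  have h5 : mlKernel α lam t * rlKernel α T ≤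
      mlKernel α lam t * (rlKernel α t * (lam * D)) := by
    have : lam * (C * rlKernel α T) = (rlKernel α t - mlKernel α lam t) * rlKernel α T := by
      rw [← h4]; ring
    linarith
  exact le_of_mul_le_mul_left h5 hgt

lemma mlKernel_pos {α lam : ℝ} (hα : 0 < α) (hα1 : α < 1) (hlam : 0 < lam) {t : ℝ} (ht : 0 < t) :
    0 < mlKernel α lam t := by
  by_contra! hneg
  set u : ℝ → ℝ := fun s => mlE α α (-(lam * s ^ α)) with hu
  have hucont : Continuous u := continuous_mlE_comp hα lam
  have hu0 : 0 < u 0 := by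
    have : u 0 = 1 / Real.Gamma α := by
      simp only [hu, Real.zero_rpow hα.ne', mul_zero, neg_zero, mlE]
      rw [tsum_eq_single 0 (fun n hn => by simp [hn])]
      simp
    rw [this]
    exact one_div_pos.2 (Real.Gamma_pos_of_pos hα)
  have hsign {s : ℝ} (hs : 0 < s) : 0 < mlKernel α lam s ↔ 0 < u s :=
    mul_pos_iff_of_pos_left (Real.rpow_pos_of_pos hs _)
  set S : Set ℝ := Ici 0 ∩ {s | u s ≤ 0}
  have hS : IsClosed S := isClosed_Ici.inter (isClosed_le hucont continuous_const)
  have hSne : S.Nonempty := ⟨t, ht.le, not_lt.1 fun h => hneg.not_gt ((hsign ht).2 h)⟩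
  have hSbdd : BddBelow S := ⟨0, fun s hs => hs.1⟩
  set T := sInf S
  have hTS : T ∈ S := hS.csInf_mem hSne hSbdd
  have hT0 : 0 < T := by
    refine lt_of_le_of_ne hTS.1 fun h => ?_
    have := hTS.2
    rw [mem_ofPred_eq, ← h] at this
    linarith
  have hgT : mlKernel α lam T ≤ 0 := not_lt.1 fun h => (hTS.2 : u T ≤ 0).not_gt ((hsign hT0).1 h)
  have hpos : ∀ s ∈ Ioo 0 T, 0 < mlKernel α lam s := fun s hs =>
    (hsign hs.1).2 (not_le.1 fun h => (csInf_le hSbdd ⟨hs.1.le, h⟩).not_gt hs.2)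
  have hΓ := Real.Gamma_pos_of_pos hα
  obtain ⟨r, hrT, hr⟩ : ∃ r ∈ Ioo (T / 2) T,
      lam * ((T - r) ^ α / (α * Real.Gamma α)) < 1 / 2 := by
    have hc : Continuous fun r : ℝ => lam * ((T - r) ^ α / (α * Real.Gamma α)) :=
      continuous_const.mul (((continuous_const.sub continuous_id).rpow_const
        fun _ => Or.inr hα.le).div_const _)
    have h0 : lam * ((T - T) ^ α / (α * Real.Gamma α)) < 1 / 2 := by
      rw [sub_self, Real.zero_rpow hα.ne']; norm_num
    have h1 : ∀ᶠ r in nhdsWithin T (Iio T), lam * ((T - r) ^ α / (α * Real.Gamma α)) < 1 / 2 :=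
      nhdsWithin_le_nhds (hc.continuousAt.eventually_lt_const h0)
    obtain ⟨r, h, h'⟩ := (h1.and (Ioo_mem_nhdsLT (by linarith : T / 2 < T))).exists
    exact ⟨r, h', h⟩
  have hr0 : 0 < r := by linarith [hrT.1]
  obtain ⟨m, hm, hmax⟩ := isCompact_Icc.exists_isMaxOn (nonempty_Icc.2 hrT.2.le)
    ((mlKernel_continuousOn hα lam).mono
      (fun s hs => hr0.trans_le hs.1 : Icc r T ⊆ Ioi 0))
  have hgm : 0 < mlKernel α lam m :=
    (hpos r ⟨hr0, hrT.2⟩).trans_le (hmax (left_mem_Icc.2 hrT.2.le))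
  have hmT : m < T := lt_of_le_of_ne hm.2 fun h => by rw [h] at hgm; linarith
  have hm0 : 0 < m := hr0.trans_le hm.1
  have hKm := rlKernel_pos hα hm0
  have hle := rlKernel_le_of_mlKernel_nonpos hα hα1 hlam hm0 hmT hpos hgT
    fun s hs => hmax ⟨hm.1.trans hs.1, hs.2⟩
  have hD : lam * ((T - m) ^ α / (α * Real.Gamma α)) < 1 / 2 := by
    refine lt_of_le_of_lt ?_ hr
    have := Real.rpow_le_rpow (by linarith : 0 ≤ T - m) (by linarith [hm.1] : T - m ≤ T - r) hα.le
    gcongr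
  have hhalf : rlKernel α m ≤ 2 * rlKernel α T := by
    have h1 : rlKernel α (T / 2) ≤ 2 * rlKernel α T := by
      simp only [rlKernel]
      rw [← mul_div_assoc]
      gcongr
      rw [Real.div_rpow hT0.le zero_le_two, div_eq_mul_inv, ← Real.rpow_neg zero_le_two, mul_comm]
      gcongr
      calc (2 : ℝ) ^ (-(α - 1)) ≤ 2 ^ (1 : ℝ) :=
            Real.rpow_le_rpow_of_exponent_le one_le_two (by linarith)
        _ = 2 := Real.rpow_one 2
    exact (rlKernel_anti hα hα1 (by linarith) (by linarith [hrT.1, hm.1])).trans h1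
  nlinarith

lemma integrableOn_mlKernel {α lam : ℝ} (hα : 0 < α) (hα1 : α < 1) (hlam : 0 < lam) :
    IntegrableOn (mlKernel α lam) (Ioi 0) := by
  refine integrableOn_Ioi_of_intervalIntegral_norm_bounded (l := atTop) (b := id) lam⁻¹ 0
    (fun t => (intervalIntegrable_mlKernel hα lam t).1) tendsto_id ?_
  filter_upwards [eventually_gt_atTop 0] with t ht
  have hK := rlKernel_pos hα ht
  have hv := mlKernel_volterra hα hlam ht
  have hg := mlKernel_pos hα hα1 hlam ht
  have hle : rlKernel α t * ∫ s in (0 : ℝ)..t, mlKernel α lam s ≤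
      ∫ s in (0 : ℝ)..t, rlKernel α (t - s) * mlKernel α lam s := by
    rw [← intervalIntegral.integral_const_mul]
    refine intervalIntegral.integral_mono_on_of_le_Ioo ht.le
      ((intervalIntegrable_mlKernel hα lam t).const_mul _)
      (intervalIntegrable_rlKernel_mul_mlKernel hα lam ht) fun s hs => ?_
    exact mul_le_mul_of_nonneg_right (rlKernel_anti hα hα1 (by linarith [hs.2]) (by linarith [hs.1]))
      (mlKernel_pos hα hα1 hlam hs.1).le
  have hnorm : ∫ s in (0 : ℝ)..t, ‖mlKernel α lam s‖ = ∫ s in (0 : ℝ)..t, mlKernel α lam s := by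
    rw [intervalIntegral.integral_of_le ht.le, intervalIntegral.integral_of_le ht.le]
    exact setIntegral_congr_fun measurableSet_Ioc fun s hs =>
      Real.norm_of_nonneg (mlKernel_pos hα hα1 hlam hs.1).le
  rw [id, hnorm, inv_eq_one_div, le_div_iff₀ hlam]
  set J := ∫ s in (0 : ℝ)..t, mlKernel α lam s
  have h1 : lam * (rlKernel α t * J) ≤ rlKernel α t * 1 := by
    have := mul_le_mul_of_nonneg_left hle hlam.le
    linarith
  refine le_of_mul_le_mul_left ?_ hK
  linarith

lemma norm_cexp_neg_mul_le_one {p : ℂ} (hp : 0 ≤ p.re) {s : ℝ} (hs : 0 ≤ s) :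
    ‖Complex.exp (-(p * s))‖ ≤ 1 := by
  rw [Complex.norm_exp, Real.exp_le_one_iff]
  simpa using mul_nonneg hp hs

lemma integrableOn_mlKernel_mul_cexp {α lam : ℝ} (hα : 0 < α) (hα1 : α < 1) (hlam : 0 < lam)
    {p : ℂ} (hp : 0 ≤ p.re) :
    IntegrableOn (fun s : ℝ => (mlKernel α lam s : ℂ) * Complex.exp (-(p * s))) (Ioi 0) := by
  refine Integrable.mul_bdd (c := 1) (integrableOn_mlKernel hα hα1 hlam).ofReal
    (by fun_prop) ?_
  filter_upwards [ae_restrict_mem measurableSet_Ioi] with s hs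
  exact norm_cexp_neg_mul_le_one hp (le_of_lt hs)

/-- The Laplace transform of the Green kernel in the open right half-plane. -/
lemma laplace_mlKernel {α lam : ℝ} (hα : 0 < α) (hα1 : α < 1) (hlam : 0 < lam)
    {p : ℂ} (hp : 0 < p.re) :
    (∫ s in Ioi (0 : ℝ), (mlKernel α lam s : ℂ) * Complex.exp (-(p * s))) *
      (p ^ (α : ℂ) + lam) = 1 := by
  have hΓ := Real.Gamma_pos_of_pos hα
  have hp0 : p ≠ 0 := by
    rintro rfl
    simp at hp
  have hpα : p ^ (α : ℂ) ≠ 0 := by simp [Complex.cpow_eq_zero_iff, hp0]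
  set f : ℝ → ℂ := fun s => (mlKernel α lam s : ℂ) * Complex.exp (-(p * s)) with hf
  set k : ℝ → ℂ := fun s => (rlKernel α s : ℂ) * Complex.exp (-(p * s)) with hk
  have hkval : ∫ s in Ioi (0 : ℝ), k s = (p ^ (α : ℂ))⁻¹ := by
    have h := integral_rpow_mul_cexp_neg_mul_Ioi hα hp
    have h2 : k = fun s : ℝ =>
        (Real.Gamma α : ℂ)⁻¹ * (((s ^ (α - 1) : ℝ) : ℂ) * Complex.exp (-(p * s))) := by
      ext s
      simp only [hk, rlKernel]
      push_cast
      ring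
    have hΓ' : (Real.Gamma α : ℂ) ≠ 0 := Complex.ofReal_ne_zero.2 hΓ.ne'
    rw [h2, integral_const_mul, h]
    field_simp
  have hkint : IntegrableOn k (Ioi 0) :=
    .of_integral_ne_zero (by rw [hkval]; exact inv_ne_zero hpα)
  have hfint : IntegrableOn f (Ioi 0) := integrableOn_mlKernel_mul_cexp hα hα1 hlam hp.le
  have hconv := integral_posConvolution hfint hkint (ContinuousLinearMap.mul ℝ ℂ)
  have hpt : ∀ t ∈ Ioi (0 : ℝ), ∫ s in (0 : ℝ)..t, (ContinuousLinearMap.mul ℝ ℂ) (f s) (k (t - s)) =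
      (lam : ℂ)⁻¹ * (k t - f t) := by
    intro t ht
    have hv := mlKernel_volterra hα hlam ht
    have h1 : ∀ s : ℝ, (ContinuousLinearMap.mul ℝ ℂ) (f s) (k (t - s)) =
        ((rlKernel α (t - s) * mlKernel α lam s : ℝ) : ℂ) * Complex.exp (-(p * t)) := by
      intro s
      simp only [hf, hk, ContinuousLinearMap.mul_apply']
      have : Complex.exp (-(p * t)) =
          Complex.exp (-(p * s)) * Complex.exp (-(p * (t - s : ℝ))) := by
        rw [← Complex.exp_add]
        congr 1
        push_cast
        ring
      rw [this]
      push_cast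
      ring
    simp_rw [h1]
    rw [intervalIntegral.integral_mul_const, intervalIntegral.integral_ofReal]
    have hlam' : (lam : ℂ) ≠ 0 := Complex.ofReal_ne_zero.2 hlam.ne'
    simp only [hf, hk]
    rw [hv]
    push_cast
    field_simp
    ring
  rw [setIntegral_congr_fun measurableSet_Ioi hpt, integral_const_mul,
    integral_sub hkint hfint, hkval, ContinuousLinearMap.mul_apply'] at hconv
  have hlam' : (lam : ℂ) ≠ 0 := Complex.ofReal_ne_zero.2 hlam.ne'
  field_simp at hconv
  linear_combination -hconv

theorem stmt_14
    (α lam : ℝ) (hα : 0 < α) (hα1 : α < 1) (hlam : 0 < lam) :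
    ∀ ξ : ℝ,
      ∫ s in Set.Ioi (0 : ℝ),
          ((s ^ (α - 1) * mlE α α (-(lam * s ^ α)) : ℝ) : ℂ) *
            Complex.exp (-(Complex.I * (ξ : ℂ) * (s : ℂ))) =
        1 / ((Complex.I * (ξ : ℂ)) ^ (α : ℂ) + (lam : ℂ)) := by
  intro ξ
  set q : ℝ → ℂ := fun c => c + Complex.I * ξ with hq
  have hqc : Continuous q := by fun_prop
  have hq0 : q 0 = Complex.I * ξ := by simp [hq]
  have hqre (c : ℝ) : (q c).re = c := by simp [hq]
  have hlim : Tendsto (fun c : ℝ => ∫ s in Ioi (0 : ℝ),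
      (mlKernel α lam s : ℂ) * Complex.exp (-(q c * s))) (nhdsWithin 0 (Ioi 0))
      (nhds (∫ s in Ioi (0 : ℝ), (mlKernel α lam s : ℂ) * Complex.exp (-(q 0 * s)))) := by
    refine tendsto_integral_filter_of_dominated_convergence (fun s => ‖mlKernel α lam s‖) ?_ ?_
      (integrableOn_mlKernel hα hα1 hlam).norm ?_
    · filter_upwards [self_mem_nhdsWithin] with c (hc : 0 < c)
      exact (integrableOn_mlKernel_mul_cexp hα hα1 hlam
        (by rw [hqre]; exact hc.le)).aestronglyMeasurable
    · filter_upwards [self_mem_nhdsWithin] with c (hc : 0 < c)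
      filter_upwards [ae_restrict_mem measurableSet_Ioi] with s hs
      rw [norm_mul, Complex.norm_real]
      exact mul_le_of_le_one_right (norm_nonneg _)
        (norm_cexp_neg_mul_le_one (by rw [hqre]; exact hc.le) (le_of_lt hs))
    · refine Eventually.of_forall fun s => ?_
      have hc : Continuous fun c : ℝ => (mlKernel α lam s : ℂ) * Complex.exp (-(q c * s)) := by
        fun_prop
      exact (hc.tendsto 0).mono_left nhdsWithin_le_nhds
  have hpow : Tendsto (fun c : ℝ => q c ^ (α : ℂ)) (nhdsWithin 0 (Ioi 0))
      (nhds (q 0 ^ (α : ℂ))) :=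
    ((Complex.continuousAt_cpow_const_of_re_pos (Or.inl (hqre 0).ge) (by simpa)).tendsto.comp
      (hqc.tendsto 0)).mono_left nhdsWithin_le_nhds
  have hone : Tendsto (fun _ : ℝ => (1 : ℂ)) (nhdsWithin 0 (Ioi 0)) (nhds 1) := tendsto_const_nhds
  have hprod := tendsto_nhds_unique
    ((hlim.mul (hpow.add_const (lam : ℂ))).congr' (by
      filter_upwards [self_mem_nhdsWithin] with c (hc : 0 < c)
      exact laplace_mlKernel hα hα1 hlam (by rwa [hqre]))) hone
  rw [hq0] at hprod
  exact eq_one_div_of_mul_eq_one_left hprod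
end
end

section
/- Let 0 < α < 1. Then the two-parameter Mittag-Leffler function E_{α,α} satisfies the asymptotic law: the first term of the standard large-argument expansion vanishes (since 1/Γ(α − α·1) = 1/Γ(0) = 0), and lim_{x → ∞, x ∈ ℝ} x² · E_{α,α}(−x) = −1/Γ(−α). In particular E_{α,α}(−x) = O(x^{−2}) as x → ∞. -/
open MeasureTheory Set Filter

noncomputable section

open Complex Topology
open scoped Real

/-- The integral of `φ` along the Hankel contour in the logarithmic coordinate `w = log z`:
the segment from `b - iπ` to `b + iπ`, together with the two half-lines `[b, ∞) ± iπ`. -/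
def hankelIntegral (φ : ℂ → ℂ) (b : ℝ) : ℂ :=
  I * (∫ θ in -π..π, φ (b + θ * I)) + ∫ v in Ioi b, (φ (v + π * I) - φ (v - π * I))

theorem tendsto_integral_vertical {φ : ℂ → ℂ} {c : ℂ}
    (hφ : ∀ w : ℂ, |w.im| ≤ π → DifferentiableAt ℂ φ w)
    (hc : Tendsto φ (comap re atBot) (𝓝 c)) :
    Tendsto (fun a : ℝ => ∫ θ in -π..π, φ (a + θ * I)) atBot (𝓝 (2 * π * c)) := by
  have hcont (a : ℝ) : ContinuousOn (fun θ : ℝ => φ (a + θ * I)) (uIcc (-π) π) := by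
    intro θ hθ
    rw [uIcc_of_le (by linarith [Real.pi_pos])] at hθ
    have h := (hφ (a + θ * I) (by simpa using abs_le.2 hθ)).continuousAt
    exact (ContinuousAt.comp (f := fun θ : ℝ => (a + θ * I : ℂ)) h
      (by fun_prop)).continuousWithinAt
  have hline (θ : ℝ) : Tendsto (fun a : ℝ => (a + θ * I : ℂ)) atBot (comap re atBot) := by
    rw [tendsto_comap_iff]
    have : re ∘ (fun a : ℝ => (a + θ * I : ℂ)) = id := by ext a; simp
    rw [this]; exact tendsto_id
  have hb := hc.norm.eventually_le_const (lt_add_one ‖c‖)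
  rw [eventually_comap] at hb
  have := intervalIntegral.tendsto_integral_filter_of_dominated_convergence
    (μ := volume) (a := -π) (b := π) (l := atBot) (F := fun (a : ℝ) (θ : ℝ) => φ (a + θ * I))
    (f := fun _ => c) (fun _ => ‖c‖ + 1) ?_ ?_ ?_ ?_
  · convert this using 2
    rw [intervalIntegral.integral_const, real_smul]; push_cast; ring
  · refine Eventually.of_forall fun a => ?_
    exact ((hcont a).mono uIoc_subset_uIcc).aestronglyMeasurable measurableSet_uIoc
  · filter_upwards [hb] with a ha
    exact Eventually.of_forall fun θ _ => ha _ (by simp)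
  · exact intervalIntegrable_const
  · exact Eventually.of_forall fun θ _ => hc.comp (hline θ)

theorem hankelIntegral_eq_integral {φ : ℂ → ℂ} {c : ℂ} (b : ℝ)
    (hφ : ∀ w : ℂ, |w.im| ≤ π → DifferentiableAt ℂ φ w)
    (hc : Tendsto φ (comap re atBot) (𝓝 c))
    (hi : Integrable fun v : ℝ => φ (v + π * I) - φ (v - π * I)) :
    hankelIntegral φ b = 2 * π * I * c + ∫ v : ℝ, (φ (v + π * I) - φ (v - π * I)) := by
  have hint (a : ℝ) {σ : ℝ} (hσ : |σ| ≤ π) :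
      IntervalIntegrable (fun v : ℝ => φ (v + σ * I)) volume a b := by
    refine Continuous.intervalIntegrable (continuous_iff_continuousAt.2 fun v => ?_) _ _
    have h := (hφ (v + σ * I) (by simpa using hσ)).continuousAt
    exact ContinuousAt.comp (f := fun v : ℝ => (v + σ * I : ℂ)) h (by fun_prop)
  have hpi := Real.pi_pos
  have hrect (a : ℝ) : I * (∫ θ in -π..π, φ (a + θ * I))
      + ∫ v in a..b, (φ (v + π * I) - φ (v - π * I)) = I * ∫ θ in -π..π, φ (b + θ * I) := by
    have h := integral_boundary_rect_eq_zero_of_differentiableOn φ (a + (-π : ℝ) * I) (b + π * I) ?_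
    · have h1 := hint a (σ := π) (by rw [abs_of_pos hpi])
      have h2 := hint a (σ := -π) (by rw [abs_neg, abs_of_pos hpi])
      have h3 : ∀ v : ℝ, (v - π * I : ℂ) = v + (-π : ℝ) * I := fun v => by push_cast; ring
      simp only [h3]
      rw [intervalIntegral.integral_sub h1 h2]
      simp at h ⊢
      linear_combination -h
    · intro w hw
      refine (hφ w ?_).differentiableWithinAt
      have := hw.2
      simp [uIcc_of_le (show -π ≤ π by linarith)] at this
      exact abs_le.2 this
  have hlim := ((tendsto_integral_vertical hφ hc).const_mul I).add
    (intervalIntegral_tendsto_integral_Iic b hi.integrableOn tendsto_id)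
  simp only [id, hrect] at hlim
  rw [hankelIntegral, tendsto_nhds_unique tendsto_const_nhds hlim, add_assoc,
    intervalIntegral.integral_Iic_add_Ioi hi.integrableOn hi.integrableOn]
  ring

theorem hankelIntegral_deriv {g g' : ℂ → ℂ} {b : ℝ} (hg : ∀ w, HasDerivAt g (g' w) w)
    (hg' : Continuous g')
    (h1 : IntegrableOn (fun v : ℝ => g' (v + π * I)) (Ioi b))
    (h2 : IntegrableOn (fun v : ℝ => g' (v - π * I)) (Ioi b))
    (h3 : Tendsto (fun v : ℝ => g (v + π * I)) atTop (𝓝 0))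
    (h4 : Tendsto (fun v : ℝ => g (v - π * I)) atTop (𝓝 0)) :
    hankelIntegral g' b = 0 := by
  have hv (θ : ℝ) : HasDerivAt (fun θ : ℝ => g (b + θ * I)) (g' (b + θ * I) * I) θ := by
    have : HasDerivAt (fun θ : ℝ => (b + θ * I : ℂ)) I θ := by
      simpa using ((hasDerivAt_id θ).ofReal_comp.mul_const I).const_add (b : ℂ)
    exact (hg _).comp θ this
  have hh (c : ℂ) (v : ℝ) : HasDerivAt (fun v : ℝ => g (v + c)) (g' (v + c)) v := by
    have : HasDerivAt (fun v : ℝ => (v + c : ℂ)) 1 v := by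
      simpa using (hasDerivAt_id v).ofReal_comp.add_const c
    have h := (hg _).comp v this
    rw [mul_one] at h
    exact h
  have e1 := intervalIntegral.integral_eq_sub_of_hasDerivAt (a := -π) (b := π)
    (fun θ _ => hv θ) (Continuous.intervalIntegrable (by fun_prop) _ _)
  rw [intervalIntegral.integral_mul_const] at e1
  have e2 := integral_Ioi_of_hasDerivAt_of_tendsto' (fun v _ => hh (π * I) v) h1 h3
  have e3 := integral_Ioi_of_hasDerivAt_of_tendsto' (a := b)
    (fun v _ => hh (-(π * I)) v) (by simpa [sub_eq_add_neg] using h2)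
    (by simpa [sub_eq_add_neg] using h4)
  rw [hankelIntegral, integral_sub h1 h2, mul_comm I, e1, e2]
  simp only [sub_eq_add_neg] at e3 ⊢
  rw [e3]
  push_cast
  rw [neg_mul]
  ring

theorem hasSum_hankelIntegral {F : ℕ → ℂ → ℂ} {φ : ℂ → ℂ} {M : ℂ → ℝ} {r b : ℝ}
    (hr : 0 ≤ r) (hr1 : r < 1) (hF : ∀ k, Continuous (F k)) (hM : Continuous M)
    (hFM : ∀ k w, b ≤ w.re → ‖F k w‖ ≤ r ^ k * M w)
    (hsum : ∀ w, b ≤ w.re → HasSum (fun k => F k w) (φ w))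
    (h1 : IntegrableOn (fun v : ℝ => M (v + π * I)) (Ioi b))
    (h2 : IntegrableOn (fun v : ℝ => M (v - π * I)) (Ioi b)) :
    HasSum (fun k => hankelIntegral (F k) b) (hankelIntegral φ b) := by
  have hs (C : ℝ) : Summable fun k : ℕ => r ^ k * C :=
    (summable_geometric_of_lt_one hr hr1).mul_right C
  refine HasSum.add (HasSum.mul_left I ?_) ?_
  · refine intervalIntegral.hasSum_integral_of_dominated_convergence
      (fun k θ => r ^ k * M (b + θ * I)) (fun k => ?_) (fun k => ?_) ?_ ?_ ?_
    · exact Continuous.aestronglyMeasurable (by fun_prop)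
    · exact Eventually.of_forall fun θ _ => hFM k _ (by simp)
    · exact Eventually.of_forall fun θ _ => hs _
    · simp_rw [tsum_mul_right]
      exact Continuous.intervalIntegrable (by fun_prop) _ _
    · exact Eventually.of_forall fun θ _ => hsum _ (by simp)
  · refine hasSum_integral_of_dominated_convergence
      (fun k v => r ^ k * (M (v + π * I) + M (v - π * I))) (fun k => ?_) (fun k => ?_) ?_ ?_ ?_
    · exact Continuous.aestronglyMeasurable (by fun_prop)
    · refine (ae_restrict_iff' measurableSet_Ioi).2 (Eventually.of_forall fun v hv => ?_)
      rw [mul_add]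
      refine (norm_sub_le _ _).trans (add_le_add (hFM k _ ?_) (hFM k _ ?_)) <;>
        simpa using (mem_Ioi.1 hv).le
    · exact Eventually.of_forall fun θ => hs _
    · simp_rw [tsum_mul_right]
      exact (h1.add h2).const_mul _
    · refine (ae_restrict_iff' measurableSet_Ioi).2 (Eventually.of_forall fun v hv => ?_)
      refine (hsum _ ?_).sub (hsum _ ?_) <;> simpa using (mem_Ioi.1 hv).le

/-- The integrand of Hankel's formula for `1 / Γ(s)` in the logarithmic coordinate. -/
def hankelKernel (s : ℝ) (w : ℂ) : ℂ := cexp (cexp w) * cexp ((1 - s) * w)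

theorem continuous_hankelKernel (s : ℝ) : Continuous (hankelKernel s) := by
  unfold hankelKernel; fun_prop

theorem differentiable_hankelKernel (s : ℝ) : Differentiable ℂ (hankelKernel s) := by
  unfold hankelKernel; fun_prop

theorem exp_add_pi_mul_I_eq (v : ℝ) : cexp (v + π * I) = ((-Real.exp v : ℝ) : ℂ) := by
  rw [Complex.exp_add, exp_pi_mul_I]; push_cast; ring

theorem exp_sub_pi_mul_I_eq (v : ℝ) : cexp (v - π * I) = ((-Real.exp v : ℝ) : ℂ) := by
  rw [Complex.exp_sub, exp_pi_mul_I]; push_cast; ring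

theorem hankelKernel_add_pi (s v : ℝ) : hankelKernel s (v + π * I) =
    (Real.exp (-Real.exp v) * Real.exp ((1 - s) * v) : ℝ) * cexp ((1 - s) * (π * I)) := by
  rw [hankelKernel, exp_add_pi_mul_I_eq, mul_add, Complex.exp_add]
  push_cast; ring

theorem hankelKernel_sub_pi (s v : ℝ) : hankelKernel s (v - π * I) =
    (Real.exp (-Real.exp v) * Real.exp ((1 - s) * v) : ℝ) * cexp (-((1 - s) * (π * I))) := by
  rw [hankelKernel, exp_sub_pi_mul_I_eq, mul_sub, sub_eq_add_neg, Complex.exp_add]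
  push_cast; ring

theorem norm_hankelKernel_add_pi (s v : ℝ) : ‖hankelKernel s (v + π * I)‖ =
    Real.exp (-Real.exp v) * Real.exp ((1 - s) * v) := by
  rw [hankelKernel_add_pi, norm_mul, norm_real, Real.norm_of_nonneg (by positivity), norm_exp]
  simp

theorem norm_hankelKernel_sub_pi (s v : ℝ) : ‖hankelKernel s (v - π * I)‖ =
    Real.exp (-Real.exp v) * Real.exp ((1 - s) * v) := by
  rw [hankelKernel_sub_pi, norm_mul, norm_real, Real.norm_of_nonneg (by positivity), norm_exp]
  simp

theorem Gamma_integrand_comp_exp (c v : ℝ) :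
    |Real.exp v| • (Real.exp (-Real.exp v) * Real.exp v ^ (c - 1)) =
      Real.exp (-Real.exp v) * Real.exp (c * v) := by
  rw [← Real.exp_mul, abs_of_pos (Real.exp_pos _), smul_eq_mul, mul_left_comm, ← Real.exp_add]
  ring_nf

theorem integrable_exp_neg_exp_mul_exp {c : ℝ} (hc : 0 < c) :
    Integrable fun v : ℝ => Real.exp (-Real.exp v) * Real.exp (c * v) := by
  have h := Real.GammaIntegral_convergent hc
  rw [← Real.range_exp, ← image_univ, integrableOn_image_iff_integrableOn_abs_deriv_smul
    MeasurableSet.univ (fun x _ => (Real.hasDerivAt_exp x).hasDerivWithinAt)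
    Real.exp_injective.injOn, integrableOn_univ] at h
  exact h.congr (Eventually.of_forall fun v => Gamma_integrand_comp_exp c v)

theorem integral_exp_neg_exp_mul_exp {c : ℝ} (hc : 0 < c) :
    ∫ v : ℝ, Real.exp (-Real.exp v) * Real.exp (c * v) = Real.Gamma c := by
  rw [Real.Gamma_eq_integral hc, ← Real.range_exp, ← image_univ,
    integral_image_eq_integral_abs_deriv_smul
    MeasurableSet.univ (fun x _ => (Real.hasDerivAt_exp x).hasDerivWithinAt)
    Real.exp_injective.injOn, Measure.restrict_univ]
  simp_rw [Gamma_integrand_comp_exp]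

theorem integrableOn_exp_neg_exp_mul_exp (c b : ℝ) :
    IntegrableOn (fun v : ℝ => Real.exp (-Real.exp v) * Real.exp (c * v)) (Ioi b) := by
  have hd : 0 < |c| + 1 := by positivity
  refine ((integrable_exp_neg_exp_mul_exp hd).integrableOn.mul_const
    (Real.exp ((c - (|c| + 1)) * b))).mono' (Continuous.aestronglyMeasurable (by fun_prop)) ?_
  refine (ae_restrict_iff' measurableSet_Ioi).2 (Eventually.of_forall fun v hv => ?_)
  rw [Real.norm_of_nonneg (by positivity), mul_assoc, ← Real.exp_add (_ * v)]
  gcongr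
  nlinarith [le_abs_self c, mem_Ioi.1 hv]

theorem integrableOn_hankelKernel_add_pi (s b : ℝ) :
    IntegrableOn (fun v : ℝ => hankelKernel s (v + π * I)) (Ioi b) := by
  simp_rw [hankelKernel_add_pi]
  exact (integrableOn_exp_neg_exp_mul_exp (1 - s) b).ofReal.mul_const _

theorem integrableOn_hankelKernel_sub_pi (s b : ℝ) :
    IntegrableOn (fun v : ℝ => hankelKernel s (v - π * I)) (Ioi b) := by
  simp_rw [hankelKernel_sub_pi]
  exact (integrableOn_exp_neg_exp_mul_exp (1 - s) b).ofReal.mul_const _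

theorem tendsto_exp_mul_comap_re_atBot {c : ℝ} (hc : 0 < c) :
    Tendsto (fun w : ℂ => cexp (c * w)) (comap re atBot) (𝓝 0) := by
  refine tendsto_exp_comap_re_atBot.comp (tendsto_comap_iff.2 ?_)
  have : re ∘ (fun w : ℂ => (c * w : ℂ)) = fun w => c * w.re := by ext w; simp
  rw [this]
  exact tendsto_comap.const_mul_atBot hc

theorem tendsto_exp_exp_comap_re_atBot :
    Tendsto (fun w : ℂ => cexp (cexp w)) (comap re atBot) (𝓝 1) := by
  rw [← Complex.exp_zero]
  exact (continuous_exp.tendsto 0).comp tendsto_exp_comap_re_atBot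

theorem hankelIntegral_hankelKernel_of_lt_one {s : ℝ} (hs : 0 < s) (hs1 : s < 1) (b : ℝ) :
    hankelIntegral (hankelKernel s) b = 2 * π * I / (Real.Gamma s : ℂ) := by
  have hc : 0 < 1 - s := sub_pos.2 hs1
  have hD (v : ℝ) : hankelKernel s (v + π * I) - hankelKernel s (v - π * I) =
      (Real.exp (-Real.exp v) * Real.exp ((1 - s) * v) : ℝ) *
        (2 * I * (Real.sin (π * s) : ℝ)) := by
    have h1 : cexp ((1 - s) * (π * I)) - cexp (-((1 - s) * (π * I))) =
        2 * I * (Real.sin (π * s) : ℝ) := by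
      rw [← Real.sin_pi_sub, show π - π * s = (1 - s) * π by ring]
      push_cast
      rw [Complex.sin, show (1 - (s : ℂ)) * (π * I) = (1 - s) * π * I by ring, ← neg_mul]
      linear_combination (cexp ((1 - (s : ℂ)) * π * I) - cexp (-((1 - (s : ℂ)) * π) * I)) * I_sq
    rw [hankelKernel_add_pi, hankelKernel_sub_pi, ← mul_sub, h1]
  rw [hankelIntegral_eq_integral (c := 0) b (fun w _ => differentiable_hankelKernel s w)]
  · simp_rw [hD]
    rw [integral_mul_const, integral_complex_ofReal, integral_exp_neg_exp_mul_exp hc]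
    have h := Real.Gamma_mul_Gamma_one_sub s
    have hsin : Real.sin (π * s) ≠ 0 :=
      (Real.sin_pos_of_pos_of_lt_pi (by positivity) (by nlinarith [Real.pi_pos])).ne'
    have hG := (Real.Gamma_pos_of_pos hs).ne'
    rw [eq_div_iff hsin] at h
    have h' : (Real.Gamma s : ℂ) * Real.Gamma (1 - s) * (Real.sin (π * s) : ℝ) = π := by
      exact_mod_cast h
    rw [eq_div_iff (by exact_mod_cast hG)]
    linear_combination 2 * I * h'
  · simpa [Function.comp_def, funext fun w => hankelKernel.eq_1 s w] using
      tendsto_exp_exp_comap_re_atBot.mul (tendsto_exp_mul_comap_re_atBot hc)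
  · simp_rw [hD]
    exact (integrable_exp_neg_exp_mul_exp hc).ofReal.mul_const _

theorem hankelIntegral_hankelKernel_one (b : ℝ) :
    hankelIntegral (hankelKernel 1) b = 2 * π * I := by
  have hD (v : ℝ) : hankelKernel 1 (v + π * I) - hankelKernel 1 (v - π * I) = 0 := by
    simp [hankelKernel_add_pi, hankelKernel_sub_pi]
  rw [hankelIntegral_eq_integral (c := 1) b (fun w _ => differentiable_hankelKernel 1 w)]
  · simp [hD]
  · simpa [funext fun w => hankelKernel.eq_1 1 w] using tendsto_exp_exp_comap_re_atBot
  · simp [hD]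

theorem hankelIntegral_hankelKernel_add_one {s : ℝ} (hs : 0 < s) (b : ℝ) :
    hankelIntegral (hankelKernel s) b = s * hankelIntegral (hankelKernel (s + 1)) b := by
  have hlim : Tendsto (fun v : ℝ => Real.exp (-Real.exp v) * Real.exp ((1 - (s + 1)) * v))
      atTop (𝓝 0) := by
    have h : Tendsto (fun v : ℝ => Real.exp ((1 - (s + 1)) * v)) atTop (𝓝 0) :=
      Real.tendsto_exp_atBot.comp (tendsto_id.const_mul_atTop_of_neg (by linarith))
    refine squeeze_zero (fun v => by positivity) (fun v => ?_) h
    exact mul_le_of_le_one_left (by positivity) (Real.exp_le_one_iff.2 (by simp [Real.exp_nonneg]))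
  have h := hankelIntegral_deriv (g := hankelKernel (s + 1))
    (g' := fun w => hankelKernel s w - s * hankelKernel (s + 1) w) (b := b) ?_ ?_ ?_ ?_ ?_ ?_
  · have hc1 := continuous_hankelKernel s
    have hc2 := continuous_hankelKernel (s + 1)
    have i1 := (integrableOn_hankelKernel_add_pi s b).sub (integrableOn_hankelKernel_sub_pi s b)
    have i2 := ((integrableOn_hankelKernel_add_pi (s + 1) b).sub
      (integrableOn_hankelKernel_sub_pi (s + 1) b)).const_mul (s : ℂ)
    have e : ∀ v : ℝ, (hankelKernel s (v + π * I) - s * hankelKernel (s + 1) (v + π * I)) -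
        (hankelKernel s (v - π * I) - s * hankelKernel (s + 1) (v - π * I)) =
        (hankelKernel s (v + π * I) - hankelKernel s (v - π * I)) -
        s * (hankelKernel (s + 1) (v + π * I) - hankelKernel (s + 1) (v - π * I)) :=
      fun v => by ring
    have j := integral_sub i1 i2
    have k := intervalIntegral.integral_sub (μ := volume) (a := -π) (b := π)
      (f := fun θ : ℝ => hankelKernel s (b + θ * I))
      (g := fun θ : ℝ => s * hankelKernel (s + 1) (b + θ * I))
      (Continuous.intervalIntegrable (by fun_prop) _ _)
      (Continuous.intervalIntegrable (by fun_prop) _ _)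
    simp only [hankelIntegral, e] at h ⊢
    simp only [Pi.sub_apply] at j
    rw [j, k, integral_const_mul, intervalIntegral.integral_const_mul] at h
    linear_combination h
  · intro w
    have h1 := (Complex.hasDerivAt_exp w).cexp
    have h2 := ((hasDerivAt_id w).const_mul (1 - ((s + 1 : ℝ) : ℂ))).cexp
    have h3 : cexp ((1 - s) * w) = cexp w * cexp ((1 - ((s + 1 : ℝ) : ℂ)) * w) := by
      rw [← Complex.exp_add]; push_cast; ring_nf
    refine (h1.mul h2).congr_deriv ?_
    simp only [hankelKernel, h3, id]
    push_cast; ring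
  · exact (continuous_hankelKernel s).sub ((continuous_hankelKernel (s + 1)).const_mul _)
  · exact (integrableOn_hankelKernel_add_pi s b).sub
      ((integrableOn_hankelKernel_add_pi (s + 1) b).const_mul _)
  · exact (integrableOn_hankelKernel_sub_pi s b).sub
      ((integrableOn_hankelKernel_sub_pi (s + 1) b).const_mul _)
  · rw [tendsto_zero_iff_norm_tendsto_zero]
    simpa only [norm_hankelKernel_add_pi] using hlim
  · rw [tendsto_zero_iff_norm_tendsto_zero]
    simpa only [norm_hankelKernel_sub_pi] using hlim

/-- Hankel's formula for the reciprocal Gamma function. -/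
theorem hankelIntegral_hankelKernel {s : ℝ} (hs : 0 < s) (b : ℝ) :
    hankelIntegral (hankelKernel s) b = 2 * π * I / (Real.Gamma s : ℂ) := by
  obtain ⟨n, hn⟩ := exists_nat_ge s
  induction n generalizing s with
  | zero => simp at hn; linarith
  | succ n ih =>
    rcases lt_trichotomy s 1 with h | rfl | h
    · exact hankelIntegral_hankelKernel_of_lt_one hs h b
    · simp [hankelIntegral_hankelKernel_one]
    · have hs' : 0 < s - 1 := by linarith
      have hstep := hankelIntegral_hankelKernel_add_one hs' b
      have hG := Real.Gamma_add_one hs'.ne'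
      rw [ih hs' (by push_cast at hn; linarith)] at hstep
      rw [sub_add_cancel] at hstep hG
      have h0 : ((s - 1 : ℝ) : ℂ) ≠ 0 := by exact_mod_cast hs'.ne'
      have hG0 : (Real.Gamma (s - 1) : ℂ) ≠ 0 := by
        exact_mod_cast (Real.Gamma_pos_of_pos hs').ne'
      rw [hG]
      refine mul_left_cancel₀ h0 (hstep.symm.trans ?_)
      rw [ofReal_mul]
      field_simp

/-- The integrand of the Hankel representation of `E_{α,α}(-x)` in the logarithmic coordinate. -/
def mittagLefflerKernel (α x : ℝ) (w : ℂ) : ℂ :=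
  cexp (cexp w) * cexp w / (cexp (α * w) + x)

theorem norm_neg_mul_exp_neg_mul {α x : ℝ} (hx : 0 < x) (w : ℂ) :
    ‖(-x : ℂ) * cexp (-(α * w))‖ = Real.exp (Real.log x - α * w.re) := by
  rw [norm_mul, norm_neg, norm_real, Real.norm_of_nonneg hx.le, norm_exp, Real.exp_sub,
    Real.exp_log hx, div_eq_mul_inv, ← Real.exp_neg]
  simp

theorem hankelIntegral_mittagLefflerKernel {α x : ℝ} (hα : 0 < α) (hx : 0 < x) :
    hankelIntegral (mittagLefflerKernel α x) ((Real.log x + 1) / α) =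
      2 * π * I * (mlE α α (-x) : ℝ) := by
  set b := (Real.log x + 1) / α with hb
  have hr (w : ℂ) (hw : b ≤ w.re) : ‖(-x : ℂ) * cexp (-(α * w))‖ ≤ Real.exp (-1) := by
    rw [norm_neg_mul_exp_neg_mul hx]
    rw [hb, div_le_iff₀ hα] at hw
    gcongr
    linarith
  have hr1 : Real.exp (-1) < 1 := by simp
  have hF (k : ℕ) (w : ℂ) : (-x : ℂ) ^ k * hankelKernel (α * k + α) w =
      hankelKernel α w * ((-x : ℂ) * cexp (-(α * w))) ^ k := by
    rw [mul_pow, ← Complex.exp_nat_mul, hankelKernel, hankelKernel,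
      show (1 - ((α * k + α : ℝ) : ℂ)) * w = (1 - α) * w + k * -(α * w) by push_cast; ring,
      Complex.exp_add]
    ring
  have hsum := hasSum_hankelIntegral
    (F := fun k w => (-x : ℂ) ^ k * hankelKernel (α * k + α) w) (φ := mittagLefflerKernel α x)
    (M := fun w => ‖hankelKernel α w‖) (b := b) (Real.exp_nonneg (-1)) hr1
    (fun k => (continuous_hankelKernel _).const_mul _) (continuous_hankelKernel α).norm ?_ ?_
    (integrableOn_hankelKernel_add_pi α b).norm (integrableOn_hankelKernel_sub_pi α b).norm
  · have hterm (k : ℕ) :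
        hankelIntegral (fun w => (-x : ℂ) ^ k * hankelKernel (α * k + α) w) b =
          2 * π * I * (((-x) ^ k / Real.Gamma (α * k + α) : ℝ) : ℂ) := by
      have h := hankelIntegral_hankelKernel (s := α * k + α) (by positivity) b
      simp only [hankelIntegral, ← mul_sub, integral_const_mul,
        intervalIntegral.integral_const_mul] at h ⊢
      push_cast
      linear_combination (-x : ℂ) ^ k * h
    simp only [hterm] at hsum
    have h2 : (2 * π * I : ℂ) ≠ 0 := two_pi_I_ne_zero
    rw [← hsum.tsum_eq, tsum_mul_left, mlE, ofReal_tsum]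
  · intro k w hw
    rw [hF, norm_mul, norm_pow, mul_comm]
    gcongr
    exact hr w hw
  · intro w hw
    have hlt := (hr w hw).trans_lt hr1
    have h := (hasSum_geometric_of_norm_lt_one hlt).mul_left (hankelKernel α w)
    simp only [hF]
    have hne : (1 : ℂ) - (-x) * cexp (-(α * w)) ≠ 0 := by
      intro h0
      rw [← sub_eq_zero.1 h0] at hlt
      simp at hlt
    have hexp : cexp (α * w) + x = cexp (α * w) * (1 - (-x) * cexp (-(α * w))) := by
      have : cexp (α * w) * cexp (-(α * w)) = 1 := by rw [← Complex.exp_add]; simp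
      linear_combination (-x : ℂ) * this
    have hφ : mittagLefflerKernel α x w =
        hankelKernel α w * (1 - (-x) * cexp (-(α * w)))⁻¹ := by
      rw [mittagLefflerKernel, hankelKernel, hexp, sub_mul, Complex.exp_sub, one_mul]
      field_simp
    rw [hφ]
    exact h

theorem mul_abs_sin_le_norm_exp_mul_I_add {x θ : ℝ} (ρ : ℝ) (hx : 0 < x) :
    x * |Real.sin θ| ≤ ‖(ρ : ℂ) * cexp (θ * I) + x‖ := by
  refine (sq_le_sq₀ (by positivity) (norm_nonneg _)).1 ?_
  rw [mul_pow, sq_abs, ← normSq_eq_norm_sq, normSq_apply]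
  simp only [add_re, add_im, re_ofReal_mul, im_ofReal_mul, exp_ofReal_mul_I_re,
    exp_ofReal_mul_I_im, ofReal_re, ofReal_im]
  linear_combination sq_nonneg (ρ + x * Real.cos θ) + (x ^ 2 - ρ ^ 2) * Real.sin_sq_add_cos_sq θ

theorem exp_mul_add_ne_zero {α x : ℝ} (hα : 0 < α) (hα1 : α < 1) (hx : 0 < x) {w : ℂ}
    (hw : |w.im| ≤ π) : cexp (α * w) + x ≠ 0 := by
  intro h
  have hre := congrArg re h
  have him := congrArg im h
  simp [exp_re, exp_im] at hre him
  obtain ⟨h1, h2⟩ := abs_le.1 hw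
  have hpi := Real.pi_pos
  rw [Real.sin_eq_zero_iff_of_lt_of_lt (by nlinarith) (by nlinarith)] at him
  rw [him, Real.cos_zero] at hre
  have := Real.exp_pos (α * w.re)
  linarith

theorem mittagLefflerKernel_sub {α x : ℝ} (hα : 0 < α) (hα1 : α < 1) (hx : 0 < x) (v : ℝ) :
    mittagLefflerKernel α x (v + π * I) - mittagLefflerKernel α x (v - π * I) =
      (Real.exp (-Real.exp v) * Real.exp ((1 + α) * v) : ℝ) * (2 * I * (Real.sin (α * π) : ℝ)) /
      (((Real.exp (α * v) : ℝ) * cexp ((α * π : ℝ) * I) + x) *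
        ((Real.exp (α * v) : ℝ) * cexp ((-(α * π) : ℝ) * I) + x)) := by
  have hpi := Real.pi_pos
  have n1 := exp_mul_add_ne_zero hα hα1 hx (w := v + π * I) (by simp [abs_of_pos hpi])
  have n2 := exp_mul_add_ne_zero hα hα1 hx (w := v - π * I) (by simp [abs_of_pos hpi])
  have e1 : cexp (α * (v + π * I)) = (Real.exp (α * v) : ℝ) * cexp ((α * π : ℝ) * I) := by
    rw [mul_add, Complex.exp_add]; push_cast; ring_nf
  have e2 : cexp (α * (v - π * I)) = (Real.exp (α * v) : ℝ) * cexp ((-(α * π) : ℝ) * I) := by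
    rw [mul_sub, sub_eq_add_neg, Complex.exp_add]; push_cast; ring_nf
  have e3 : 2 * I * ((Real.sin (α * π) : ℝ) : ℂ) =
      cexp ((α * π : ℝ) * I) - cexp ((-(α * π) : ℝ) * I) := by
    push_cast
    rw [Complex.sin]
    linear_combination (cexp (-(α * π) * I) - cexp (α * π * I)) * I_sq
  rw [e1] at n1
  rw [e2] at n2
  rw [mittagLefflerKernel, mittagLefflerKernel, exp_add_pi_mul_I_eq, exp_sub_pi_mul_I_eq, e1, e2,
    div_sub_div _ _ n1 n2, e3,
    show (1 + α) * v = v + α * v by ring, Real.exp_add]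
  push_cast
  ring

theorem sin_mul_pi_pos {α : ℝ} (hα : 0 < α) (hα1 : α < 1) : 0 < Real.sin (α * π) :=
  Real.sin_pos_of_pos_of_lt_pi (by positivity) (by nlinarith [Real.pi_pos])

theorem norm_sq_mul_mittagLefflerKernel_sub_le {α x : ℝ} (hα : 0 < α) (hα1 : α < 1) (hx : 0 < x)
    (v : ℝ) :
    ‖(x : ℂ) ^ 2 * (mittagLefflerKernel α x (v + π * I) - mittagLefflerKernel α x (v - π * I))‖ ≤
      Real.exp (-Real.exp v) * Real.exp ((1 + α) * v) * (2 / Real.sin (α * π)) := by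
  have hsin := sin_mul_pi_pos hα hα1
  have h1 := mul_abs_sin_le_norm_exp_mul_I_add (θ := α * π) (Real.exp (α * v)) hx
  have h2 := mul_abs_sin_le_norm_exp_mul_I_add (θ := -(α * π)) (Real.exp (α * v)) hx
  rw [Real.sin_neg, abs_neg] at h2
  rw [abs_of_pos hsin] at h1 h2
  have h3 : ‖(2 * I * (Real.sin (α * π) : ℝ) : ℂ)‖ = 2 * Real.sin (α * π) := by
    rw [norm_mul, norm_real, Real.norm_of_nonneg hsin.le]; simp
  rw [mittagLefflerKernel_sub hα hα1 hx, norm_mul, norm_div, norm_mul, h3, norm_mul, norm_pow,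
    norm_real, norm_real, Real.norm_of_nonneg hx.le, Real.norm_of_nonneg (by positivity)]
  set E := Real.exp (-Real.exp v) * Real.exp ((1 + α) * v)
  calc _ ≤ x ^ 2 * (E * (2 * Real.sin (α * π)) /
        ((x * Real.sin (α * π)) * (x * Real.sin (α * π)))) := by
        gcongr
    _ = _ := by field_simp

theorem tendsto_sq_mul_mittagLefflerKernel_sub {α : ℝ} (hα : 0 < α) (hα1 : α < 1) (v : ℝ) :
    Tendsto (fun x : ℝ => (x : ℂ) ^ 2 *
      (mittagLefflerKernel α x (v + π * I) - mittagLefflerKernel α x (v - π * I))) atTop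
      (𝓝 ((Real.exp (-Real.exp v) * Real.exp ((1 + α) * v) : ℝ) *
        (2 * I * (Real.sin (α * π) : ℝ)))) := by
  have hinv : Tendsto (fun x : ℝ => ((x⁻¹ : ℝ) : ℂ)) atTop (𝓝 0) := by
    exact (continuous_ofReal.tendsto' 0 0 ofReal_zero).comp tendsto_inv_atTop_zero
  have hA (c : ℂ) : Tendsto (fun x : ℝ => c * ((x⁻¹ : ℝ) : ℂ) + 1) atTop (𝓝 1) := by
    simpa using (hinv.const_mul c).add_const 1
  have h := (tendsto_const_nhds (x := ((Real.exp (-Real.exp v) * Real.exp ((1 + α) * v) : ℝ) *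
        (2 * I * (Real.sin (α * π) : ℝ)) : ℂ))).div
    ((hA ((Real.exp (α * v) : ℝ) * cexp ((α * π : ℝ) * I))).mul
      (hA ((Real.exp (α * v) : ℝ) * cexp ((-(α * π) : ℝ) * I)))) (by simp)
  rw [mul_one, div_one] at h
  refine h.congr' ?_
  filter_upwards [eventually_gt_atTop 0] with x hx
  have hx0 : (x : ℂ) ≠ 0 := by exact_mod_cast hx.ne'
  have hfac (c : ℂ) : c + x = x * (c * ((x⁻¹ : ℝ) : ℂ) + 1) := by
    push_cast; field_simp
  rw [mittagLefflerKernel_sub hα hα1 hx, hfac, hfac, mul_mul_mul_comm, ← sq, ← mul_div_assoc,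
    mul_div_mul_left _ _ (pow_ne_zero 2 hx0)]
  rfl

theorem continuous_mittagLefflerKernel_sub {α x : ℝ} (hα : 0 < α) (hα1 : α < 1) (hx : 0 < x) :
    Continuous fun v : ℝ =>
      mittagLefflerKernel α x (v + π * I) - mittagLefflerKernel α x (v - π * I) := by
  have hpi := Real.pi_pos
  unfold mittagLefflerKernel
  refine Continuous.sub (Continuous.div (by fun_prop) (by fun_prop) fun v => ?_)
    (Continuous.div (by fun_prop) (by fun_prop) fun v => ?_) <;>
  exact exp_mul_add_ne_zero hα hα1 hx (by simp [abs_of_pos hpi])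

/-- The representation of `E_{α,α}(-x)` by a real integral, obtained by collapsing the Hankel
contour onto the negative real axis. -/
theorem integral_mittagLefflerKernel_sub {α x : ℝ} (hα : 0 < α) (hα1 : α < 1) (hx : 0 < x) :
    ∫ v : ℝ, (mittagLefflerKernel α x (v + π * I) - mittagLefflerKernel α x (v - π * I)) =
      2 * π * I * (mlE α α (-x) : ℝ) := by
  have hx0 : (x : ℂ) ≠ 0 := by exact_mod_cast hx.ne'
  rw [← hankelIntegral_mittagLefflerKernel hα hx, hankelIntegral_eq_integral (c := 0)]
  · simp
  · intro w hw
    unfold mittagLefflerKernel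
    exact DifferentiableAt.div (by fun_prop) (by fun_prop) (exp_mul_add_ne_zero hα hα1 hx hw)
  · have h := (tendsto_exp_exp_comap_re_atBot.mul tendsto_exp_comap_re_atBot).div
      ((tendsto_exp_mul_comap_re_atBot hα).add_const (x : ℂ)) (by simpa using hx0)
    rw [mul_zero, zero_div] at h
    exact h
  · have h : Integrable fun v : ℝ => (x : ℂ) ^ 2 *
        (mittagLefflerKernel α x (v + π * I) - mittagLefflerKernel α x (v - π * I)) :=
      ((integrable_exp_neg_exp_mul_exp (by linarith : 0 < 1 + α)).mul_const _).mono'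
        ((continuous_mittagLefflerKernel_sub hα hα1 hx).const_mul _).aestronglyMeasurable
        (Eventually.of_forall fun v => norm_sq_mul_mittagLefflerKernel_sub_le hα hα1 hx v)
    exact (integrable_const_mul_iff (pow_ne_zero 2 hx0).isUnit _).1 h

theorem tendsto_sq_mul_mlE {α : ℝ} (hα : 0 < α) (hα1 : α < 1) :
    Tendsto (fun x : ℝ => x ^ 2 * mlE α α (-x)) atTop (𝓝 (-1 / Real.Gamma (-α))) := by
  have hα' : 0 < 1 + α := by linarith
  have hlim := tendsto_integral_filter_of_dominated_convergence (μ := volume) (l := atTop)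
    (F := fun (x : ℝ) (v : ℝ) => (x : ℂ) ^ 2 *
      (mittagLefflerKernel α x (v + π * I) - mittagLefflerKernel α x (v - π * I)))
    (fun v => Real.exp (-Real.exp v) * Real.exp ((1 + α) * v) * (2 / Real.sin (α * π)))
    ((eventually_gt_atTop 0).mono fun x hx =>
      ((continuous_mittagLefflerKernel_sub hα hα1 hx).const_mul _).aestronglyMeasurable)
    ((eventually_gt_atTop 0).mono fun x hx => Eventually.of_forall fun v =>
      norm_sq_mul_mittagLefflerKernel_sub_le hα hα1 hx v)
    ((integrable_exp_neg_exp_mul_exp hα').mul_const _)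
    (Eventually.of_forall fun v => tendsto_sq_mul_mittagLefflerKernel_sub hα hα1 v)
  rw [integral_mul_const, integral_complex_ofReal, integral_exp_neg_exp_mul_exp hα'] at hlim
  have hsin := (sin_mul_pi_pos hα hα1).ne'
  have hpi := Real.pi_ne_zero
  have hrefl : Real.Gamma (1 + α) * Real.sin (α * π) / π = -1 / Real.Gamma (-α) := by
    have h := Real.Gamma_mul_Gamma_one_sub (-α)
    rw [mul_neg, Real.sin_neg, sub_neg_eq_add, mul_comm π, eq_div_iff (neg_ne_zero.2 hsin)] at h
    have hG : Real.Gamma (-α) ≠ 0 := by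
      rintro h0
      rw [h0, zero_mul, zero_mul] at h
      exact hpi h.symm
    field_simp
    linear_combination -h
  rw [← hrefl]
  have h2 : (2 * π * I : ℂ) ≠ 0 := two_pi_I_ne_zero
  have hre := (continuous_re.tendsto _).comp (hlim.const_mul (2 * π * I : ℂ)⁻¹)
  have hval : (2 * π * I : ℂ)⁻¹ * ((Real.Gamma (1 + α) : ℝ) * (2 * I * (Real.sin (α * π) : ℝ))) =
      ((Real.Gamma (1 + α) * Real.sin (α * π) / π : ℝ) : ℂ) := by
    have : (π : ℂ) ≠ 0 := by exact_mod_cast hpi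
    push_cast
    field_simp
  rw [hval, ofReal_re] at hre
  refine hre.congr' ?_
  filter_upwards [eventually_gt_atTop 0] with x hx
  have : (2 * π * I : ℂ)⁻¹ * ((x : ℂ) ^ 2 * (2 * π * I * (mlE α α (-x) : ℝ))) =
      ((x ^ 2 * mlE α α (-x) : ℝ) : ℂ) := by
    push_cast
    field_simp
  rw [Function.comp_apply, integral_const_mul, integral_mittagLefflerKernel_sub hα hα1 hx, this,
    ofReal_re]

theorem stmt_16
    (α : ℝ) (hα : 0 < α) (hα1 : α < 1) :
    Tendsto (fun x : ℝ => x ^ 2 * mlE α α (-x)) atTop (nhds (-1 / Real.Gamma (-α))) ∧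
      (fun x : ℝ => mlE α α (-x)) =O[atTop] fun x : ℝ => x ^ (-2 : ℝ) := by
  have h := tendsto_sq_mul_mlE hα hα1
  refine ⟨h, ?_⟩
  have hO := (Asymptotics.isBigO_refl (fun x : ℝ => x ^ (-2 : ℝ)) atTop).mul (h.isBigO_one ℝ)
  refine hO.congr' ?_ (by simp)
  filter_upwards [eventually_gt_atTop 0] with x hx
  rw [Real.rpow_neg hx.le, Real.rpow_two]
  field_simp
end
end
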